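/- Let k ⊆ l be number fields, let 𝔐 ⊆ O_l be a full O_k-module generated by a k-basis ω₁, …, ω_e of l with e = [l : k], and let β ≠ 0 be an element of O_k. Assume the group E_{l/k}(𝔐) of relative units has positive rank r(l/k), and let ε₁, …, ε_{r(l/k)} be multiplicatively independent elements of E_{l/k}(𝔐). If the set {μ ∈ 𝔐 : Norm_{l/k}(μ) ∈ Tor(O_k^×)·β} is nonempty, then it contains an element μ′ satisfying h(μ′) ≤ (1/2)·∑_{j=1}^{r(l/k)} h(ε_j) + [l : k]^{-1}·h(β). -/

import Mathlib

open NumberField Module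

/-- The normalized logarithmic absolute value `log |x|_w` at an infinite place `w`
of a number field `F`, where `|·|_w = ‖·‖_w^{d_w/d}`. -/
noncomputable def infLogAbs (F : Type*) [Field F] [NumberField F]
    (w : InfinitePlace F) (x : F) : ℝ :=
  (w.mult : ℝ) / (finrank ℚ F : ℝ) * Real.log (w x)

/-- The normalized logarithmic absolute value `log |x|_v` at a finite place `v`
of a number field `F`. -/
noncomputable def finLogAbs (F : Type*) [Field F] [NumberField F]
    (v : IsDedekindDomain.HeightOneSpectrum (𝓞 F)) (x : F) : ℝ :=
  if h : (v.valuation (K := F)) x = 0 then 0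
  else ((Multiplicative.toAdd (WithZero.unzero h) : ℤ) : ℝ) / (finrank ℚ F : ℝ) *
    Real.log (Ideal.absNorm v.asIdeal)

/-- The absolute logarithmic Weil height `h(x) = ∑_w log⁺ |x|_w`, the sum running over
all (infinite and finite) places of the number field `F`. -/
noncomputable def weilHeight (F : Type*) [Field F] [NumberField F] (x : F) : ℝ :=
  (∑ w : InfinitePlace F, max 0 (infLogAbs F w x)) +
    ∑ᶠ v : IsDedekindDomain.HeightOneSpectrum (𝓞 F), max 0 (finLogAbs F v x)

/-- The full `O_k`-module `𝔐` generated by elements `ω i` of `l`. -/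
def fullModule (K : Type*) [Field K] [NumberField K] {L : Type*} [Field L]
    [Algebra K L] {e : ℕ} (ω : Fin e → L) : Set L :=
  {x | ∃ ν : Fin e → 𝓞 K, x = ∑ i, algebraMap K L (ν i : K) * ω i}

/-- The coefficient ring `O_𝔐 = {α ∈ l : α𝔐 ⊆ 𝔐}` of a full module `𝔐 ⊆ l`. -/
def coeffRing {L : Type*} [Field L] (M : Set L) : Set L :=
  {α | ∀ x ∈ M, α * x ∈ M}

/-- The unit group `O_𝔐^× = O_𝔐 ∩ O_l^×` of the coefficient ring. -/
def coeffRingUnits {L : Type*} [Field L] [NumberField L] (M : Set L) : Set L :=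
  {α | α ∈ coeffRing M ∧ ∃ u : (𝓞 L)ˣ, ((u : 𝓞 L) : L) = α}

/-- The group `E_{l/k}(𝔐) = {α ∈ O_𝔐^× : Norm_{l/k}(α) ∈ Tor(O_k^×)}` of relative units. -/
def relUnits (K : Type*) [Field K] [NumberField K] (L : Type*) [Field L] [NumberField L]
    [Algebra K L] (M : Set L) : Set L :=
  {α | α ∈ coeffRingUnits M ∧ ∃ n : ℕ, 0 < n ∧ (Algebra.norm K α) ^ n = 1}

/-- A family of elements of `Lˣ` is multiplicatively independent if no nontrivial
integer-power product of them equals `1`. -/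
def MulIndep {L : Type*} [Field L] {r : ℕ} (ε : Fin r → L) : Prop :=
  ∀ m : Fin r → ℤ, (∏ j, ε j ^ m j) = 1 → m = 0

open scoped Classical in
/-- The set of infinite places of `L` lying above an infinite place `v` of `K`. -/
noncomputable def placesAbove (K : Type*) [Field K] (L : Type*) [Field L] [NumberField L]
    [Algebra K L] (v : InfinitePlace K) : Finset (InfinitePlace L) :=
  Finset.univ.filter (fun w => w.comap (algebraMap K L) = v)


section LogVector

variable {K L : Type*} [Field K] [NumberField K] [Field L] [NumberField L] [Algebra K L]

open scoped Classical in
/-- The local-global formula for the relative norm at an archimedean place. -/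
theorem infinitePlace_norm_pow_mult (v : InfinitePlace K) (x : L) :
    v (Algebra.norm K x) ^ v.mult = ∏ w ∈ placesAbove K L v, w x ^ w.mult := by
  have hfib (ψ : K →+* ℂ) :
      ‖ψ (Algebra.norm K x)‖ =
        ∏ φ : L →+* ℂ with φ.comp (algebraMap K L) = ψ, ‖φ x‖ := by
    let _ : Algebra K ℂ := ψ.toAlgebra
    have h := congrArg (‖·‖) (Algebra.norm_eq_prod_embeddings K ℂ x)
    rw [norm_prod] at h
    refine h.trans (Finset.prod_bij (fun σ _ => (σ : L →+* ℂ)) ?_ ?_ ?_ ?_)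
    · intro σ _
      simp only [Finset.mem_filter, Finset.mem_univ, true_and]
      exact σ.comp_algebraMap
    · intro σ _ τ _ h
      exact AlgHom.coe_ringHom_injective h
    · intro φ hφ
      simp only [Finset.mem_filter, Finset.mem_univ, true_and] at hφ
      exact ⟨{ φ with commutes' := fun r => RingHom.congr_fun hφ r }, Finset.mem_univ _, rfl⟩
    · intro σ _
      rfl
  calc v (Algebra.norm K x) ^ v.mult
      = ∏ ψ : K →+* ℂ with InfinitePlace.mk ψ = v, ‖ψ (Algebra.norm K x)‖ := by
        rw [← InfinitePlace.card_filter_mk_eq v]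
        refine (Finset.prod_eq_pow_card fun ψ hψ => ?_).symm
        rw [← (Finset.mem_filter.mp hψ).2, InfinitePlace.apply]
    _ = ∏ φ : L →+* ℂ with InfinitePlace.mk (φ.comp (algebraMap K L)) = v, ‖φ x‖ := by
        rw [Finset.prod_congr rfl fun ψ _ => hfib ψ,
          ← Finset.prod_fiberwise_of_maps_to
            (g := fun φ : L →+* ℂ => φ.comp (algebraMap K L))
            (t := Finset.univ.filter fun ψ : K →+* ℂ => InfinitePlace.mk ψ = v) (by simp)]
        refine Finset.prod_congr rfl fun ψ hψ => Finset.prod_congr ?_ fun _ _ => rfl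
        ext φ
        simp only [Finset.mem_filter, Finset.mem_univ, true_and] at hψ ⊢
        exact ⟨fun h => ⟨h ▸ hψ, h⟩, fun h => h.2⟩
    _ = ∏ w ∈ placesAbove K L v, w x ^ w.mult := by
        rw [← Finset.prod_fiberwise_of_maps_to (g := InfinitePlace.mk)
            (t := placesAbove K L v) (by simp [placesAbove, InfinitePlace.comap_mk])]
        refine Finset.prod_congr rfl fun w hw => ?_
        rw [← InfinitePlace.card_filter_mk_eq w]
        have hset : ((Finset.univ.filter fun φ : L →+* ℂ =>
            InfinitePlace.mk (φ.comp (algebraMap K L)) = v).filter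
              fun φ => InfinitePlace.mk φ = w) =
            Finset.univ.filter fun φ : L →+* ℂ => InfinitePlace.mk φ = w := by
          ext φ
          simp only [placesAbove, Finset.mem_filter, Finset.mem_univ, true_and] at hw ⊢
          refine ⟨fun h => h.2, fun h => ⟨?_, h⟩⟩
          rw [← InfinitePlace.comap_mk, h, hw]
        rw [hset]
        refine Finset.prod_eq_pow_card fun φ hφ => ?_
        rw [← (Finset.mem_filter.mp hφ).2, InfinitePlace.apply]

/-- The unnormalized logarithmic vector `w ↦ d_w log ‖x‖_w` of an element. -/
noncomputable def logVec (F : Type*) [Field F] [NumberField F] (x : F) : InfinitePlace F → ℝ :=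
  fun w => w.mult * Real.log (w x)

theorem logVec_mul {x y : L} (hx : x ≠ 0) (hy : y ≠ 0) :
    logVec L (x * y) = logVec L x + logVec L y := by
  ext w
  simp only [logVec, map_mul, Pi.add_apply]
  rw [Real.log_mul (by simpa using hx) (by simpa using hy), mul_add]

theorem logVec_one : logVec L (1 : L) = 0 := by
  ext w
  simp [logVec]

theorem logVec_zpow (x : L) (n : ℤ) : logVec L (x ^ n) = (n : ℝ) • logVec L x := by
  ext w
  simp only [logVec, map_zpow₀, Real.log_zpow, Pi.smul_apply, smul_eq_mul]
  ring

theorem logVec_pow (x : L) (n : ℕ) : logVec L (x ^ n) = (n : ℝ) • logVec L x := by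
  simpa using logVec_zpow x n

theorem logVec_inv (x : L) : logVec L x⁻¹ = -logVec L x := by
  simpa using logVec_zpow x (-1)

theorem logVec_prod {ι : Type*} (s : Finset ι) (f : ι → L) (hf : ∀ i ∈ s, f i ≠ 0) :
    logVec L (∏ i ∈ s, f i) = ∑ i ∈ s, logVec L (f i) := by
  classical
  induction s using Finset.induction_on with
  | empty => simpa using logVec_one
  | insert i s hi ih =>
    rw [Finset.prod_insert hi, Finset.sum_insert hi, logVec_mul (hf i (by simp))
      (Finset.prod_ne_zero_iff.mpr fun j hj => hf j (by simp [hj])),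
      ih fun j hj => hf j (by simp [hj])]

theorem logVec_eq_zero_of_pow_eq_one {x : L} {n : ℕ} (hn : 0 < n) (h : x ^ n = 1) :
    logVec L x = 0 := by
  have h1 := logVec_pow x n
  rw [h, logVec_one] at h1
  exact (smul_eq_zero.mp h1.symm).resolve_left (by positivity)

theorem sum_placesAbove_logVec (v : InfinitePlace K) {x : L} (hx : x ≠ 0) :
    ∑ w ∈ placesAbove K L v, logVec L x w = logVec K (Algebra.norm K x) v := by
  have h := congrArg Real.log (infinitePlace_norm_pow_mult v x)
  rw [Real.log_pow, Real.log_prod (fun w _ => by simpa using hx)] at h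
  rw [logVec, h]
  simp [logVec, Real.log_pow]

theorem sum_placesAbove_mult (v : InfinitePlace K) :
    ∑ w ∈ placesAbove K L v, (w.mult : ℝ) = finrank K L * v.mult := by
  have h := sum_placesAbove_logVec (L := L) v (x := 2) (by norm_num)
  have h2 : Algebra.norm K (2 : L) = 2 ^ finrank K L := by
    rw [← Algebra.norm_algebraMap (S := L) (2 : K), map_ofNat (algebraMap K L)]
  have hK : v (2 : K) = 2 := by simpa using v.map_natCast 2
  have hL (w : InfinitePlace L) : w (2 : L) = 2 := by simpa using w.map_natCast 2
  rw [h2, logVec_pow, Pi.smul_apply] at h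
  simp only [logVec, hK, hL, ← Finset.sum_mul, smul_eq_mul, ← mul_assoc] at h
  exact mul_right_cancel₀ (Real.log_pos one_lt_two).ne' h

theorem sum_eq_sum_placesAbove (f : InfinitePlace L → ℝ) :
    ∑ w, f w = ∑ v : InfinitePlace K, ∑ w ∈ placesAbove K L v, f w := by
  classical
  simp only [placesAbove]
  exact (Finset.sum_fiberwise _ _ _).symm

end LogVector

section UnitLattice

open NumberField.Units NumberField.Units.dirichletUnitTheorem

theorem mem_span_logVec_units {L : Type*} [Field L] [NumberField L] (z : InfinitePlace L → ℝ)
    (hz : ∑ w, z w = 0) :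
    z ∈ Submodule.span ℝ (Set.range fun u : (𝓞 L)ˣ => logVec L ((u : 𝓞 L) : L)) := by
  classical
  let T : logSpace L →ₗ[ℝ] (InfinitePlace L → ℝ) :=
    LinearMap.pi fun w => if h : w = w₀ then -∑ w', LinearMap.proj w'
      else LinearMap.proj (⟨w, h⟩ : {w : InfinitePlace L // w ≠ w₀})
  have hT (y : InfinitePlace L → ℝ) (hy : ∑ w, y w = 0) : T (fun w => y w) = y := by
    ext w
    by_cases h : w = w₀
    · subst h
      simp only [T, LinearMap.pi_apply, dite_true, LinearMap.neg_apply, LinearMap.sum_apply,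
        LinearMap.proj_apply]
      rw [← Finset.add_sum_erase _ _ (Finset.mem_univ w₀)] at hy
      rw [Finset.sum_subtype (Finset.univ.erase w₀) (p := fun w => w ≠ w₀) (by simp)] at hy
      linarith
    · simp [T, h]
  have hmem : (fun w : {w : InfinitePlace L // w ≠ w₀} => z w) ∈
      Submodule.span ℝ (unitLattice L : Set (logSpace L)) := by
    rw [unitLattice_span_eq_top]
    trivial
  have h := Submodule.mem_map_of_mem (f := T) hmem
  rw [hT z hz, Submodule.map_span] at h
  refine Submodule.span_mono ?_ h
  rintro _ ⟨y, hy, rfl⟩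
  obtain ⟨u, -, rfl⟩ := hy
  refine ⟨u.toMul, ?_⟩
  exact (hT (logVec L _) (sum_mult_mul_log u.toMul)).symm

end UnitLattice

section FullModule

variable {K L : Type*} [Field K] [NumberField K] [Field L] [Algebra K L]
  {e : ℕ} (b : Basis (Fin e) K L)

theorem mem_fullModule_iff (x : L) :
    x ∈ fullModule K (fun i => b i) ↔ ∀ i, IsIntegral ℤ (b.repr x i) := by
  constructor
  · rintro ⟨ν, rfl⟩ i
    have h : b.repr (∑ i, algebraMap K L (ν i : K) * b i) i = ν i := by
      simp_rw [← Algebra.smul_def]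
      exact congrFun (b.repr_sum_self fun i => (ν i : K)) i
    rw [h]
    exact (ν i).isIntegral_coe
  · intro h
    refine ⟨fun i => ⟨b.repr x i, h i⟩, ?_⟩
    simp_rw [← Algebra.smul_def]
    exact (b.sum_repr x).symm

theorem add_mem_fullModule {x y : L} (hx : x ∈ fullModule K (fun i => b i))
    (hy : y ∈ fullModule K (fun i => b i)) : x + y ∈ fullModule K (fun i => b i) := by
  rw [mem_fullModule_iff] at *
  intro i
  simpa using (hx i).add (hy i)

theorem zsmul_mem_fullModule (n : ℤ) {x : L} (hx : x ∈ fullModule K (fun i => b i)) :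
    n • x ∈ fullModule K (fun i => b i) := by
  rw [mem_fullModule_iff] at *
  intro i
  rw [map_zsmul, Finsupp.smul_apply]
  exact (hx i).smul n

theorem sum_mem_fullModule {ι : Type*} (s : Finset ι) (f : ι → L)
    (hf : ∀ i ∈ s, f i ∈ fullModule K (fun i => b i)) :
    ∑ i ∈ s, f i ∈ fullModule K (fun i => b i) := by
  rw [mem_fullModule_iff]
  intro i
  rw [map_sum, Finsupp.finsetSum_apply]
  exact IsIntegral.sum _ fun j hj => (mem_fullModule_iff b _).mp (hf j hj) i

theorem isIntegral_of_mem_fullModule (hb : ∀ i, IsIntegral ℤ (b i)) {x : L}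
    (hx : x ∈ fullModule K (fun i => b i)) : IsIntegral ℤ x := by
  obtain ⟨ν, rfl⟩ := hx
  exact IsIntegral.sum _ fun i _ => ((ν i).isIntegral_coe.algebraMap).mul (hb i)

theorem exists_zsmul_mem_fullModule (x : L) :
    ∃ n : ℤ, n ≠ 0 ∧ n • x ∈ fullModule K (fun i => b i) := by
  have h (i : Fin e) : ∃ n : ℤ, n ≠ 0 ∧ IsIntegral ℤ (n • b.repr x i) :=
    ((IsFractionRing.isAlgebraic_iff ℤ ℚ K).mpr
      (Algebra.IsAlgebraic.isAlgebraic (b.repr x i))).exists_integral_multiple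
  choose n hn hi using h
  refine ⟨∏ i, n i, Finset.prod_ne_zero_iff.mpr fun i _ => hn i, ?_⟩
  rw [mem_fullModule_iff]
  intro i
  rw [← Finset.prod_erase_mul _ _ (Finset.mem_univ i), mul_smul, map_zsmul, map_zsmul,
    Finsupp.smul_apply, Finsupp.smul_apply]
  exact (hi i).smul (∏ j ∈ Finset.univ.erase i, n j)

theorem mul_mem_coeffRing {M : Set L} {x y : L} (hx : x ∈ coeffRing M) (hy : y ∈ coeffRing M) :
    x * y ∈ coeffRing M := fun z hz => by
  rw [mul_assoc]
  exact hx _ (hy _ hz)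

theorem one_mem_coeffRing {M : Set L} : (1 : L) ∈ coeffRing M := fun z hz => by
  rwa [one_mul]

theorem pow_mem_coeffRing {M : Set L} {x : L} (hx : x ∈ coeffRing M) (n : ℕ) :
    x ^ n ∈ coeffRing M := by
  induction n with
  | zero => simpa using one_mem_coeffRing
  | succ n ih => exact pow_succ x n ▸ mul_mem_coeffRing ih hx

theorem unit_ne_zero (u : (𝓞 L)ˣ) : ((u : 𝓞 L) : L) ≠ 0 := by
  simp

theorem coe_inv_unit (u : (𝓞 L)ˣ) :
    (((u⁻¹ : (𝓞 L)ˣ) : 𝓞 L) : L) = ((u : 𝓞 L) : L)⁻¹ := by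
  refine eq_inv_of_mul_eq_one_left ?_
  rw [← map_mul, Units.inv_mul, map_one]

variable [NumberField L]

theorem exists_zsmul_integers_subset_fullModule :
    ∃ n : ℤ, n ≠ 0 ∧ ∀ x : L, IsIntegral ℤ x → n • x ∈ fullModule K (fun i => b i) := by
  choose n hn hi using fun j => exists_zsmul_mem_fullModule b (RingOfIntegers.basis L j : L)
  refine ⟨∏ j, n j, Finset.prod_ne_zero_iff.mpr fun j _ => hn j, fun x hx => ?_⟩
  have hrep := congrArg (algebraMap (𝓞 L) L)
    ((RingOfIntegers.basis L).sum_repr (⟨x, hx⟩ : 𝓞 L))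
  rw [map_sum] at hrep
  have hx' : (algebraMap (𝓞 L) L) ⟨x, hx⟩ = x := rfl
  rw [← hx', ← hrep, Finset.smul_sum]
  refine sum_mem_fullModule b _ _ fun j _ => ?_
  rw [map_zsmul, smul_comm, ← Finset.prod_erase_mul _ _ (Finset.mem_univ j), mul_smul]
  exact zsmul_mem_fullModule b _ (zsmul_mem_fullModule b _ (hi j))

theorem exists_pow_mem_coeffRing (hb : ∀ i, IsIntegral ℤ (b i)) (u : (𝓞 L)ˣ) :
    ∃ m : ℕ, 0 < m ∧ ((u : 𝓞 L) : L) ^ m ∈ coeffRing (fullModule K (fun i => b i)) := by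
  obtain ⟨n, hn, hM⟩ := exists_zsmul_integers_subset_fullModule b
  let I : Ideal (𝓞 L) := Ideal.span {(n : 𝓞 L)}
  have hI : I ≠ ⊥ := by
    simpa [I, Ideal.span_singleton_eq_bot] using hn
  have : Finite (𝓞 L ⧸ I) := Ideal.finiteQuotientOfFreeOfNeBot I hI
  obtain ⟨m, hm, hum⟩ := isOfFinOrder_iff_pow_eq_one.mp
    (isOfFinOrder_of_finite (Units.map (Ideal.Quotient.mk I : 𝓞 L →* 𝓞 L ⧸ I) u))
  refine ⟨m, hm, fun x hx => ?_⟩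
  have h1 : Ideal.Quotient.mk I ((u : 𝓞 L) ^ m) = Ideal.Quotient.mk I 1 := by
    simpa using congrArg Units.val hum
  rw [Ideal.Quotient.eq, Ideal.mem_span_singleton] at h1
  obtain ⟨c, hc⟩ := h1
  have hc' : ((u : 𝓞 L) : L) ^ m = 1 + n * (c : L) := by
    have := congrArg (algebraMap (𝓞 L) L) hc
    simp only [map_sub, map_pow, map_one, map_mul, map_intCast] at this
    linear_combination this
  have hx' : ((u : 𝓞 L) : L) ^ m * x = x + n • ((c : L) * x) := by
    rw [hc', zsmul_eq_mul]
    ring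
  rw [hx']
  exact add_mem_fullModule b hx
    (hM _ (c.isIntegral_coe.mul (isIntegral_of_mem_fullModule b hb hx)))

theorem inv_mem_coeffRing (hb : ∀ i, IsIntegral ℤ (b i)) (u : (𝓞 L)ˣ)
    (hu : ((u : 𝓞 L) : L) ∈ coeffRing (fullModule K (fun i => b i))) :
    ((u : 𝓞 L) : L)⁻¹ ∈ coeffRing (fullModule K (fun i => b i)) := by
  obtain ⟨m, hm, h⟩ := exists_pow_mem_coeffRing b hb u⁻¹
  have h' : ((u : 𝓞 L) : L)⁻¹ =
      (((u⁻¹ : (𝓞 L)ˣ) : 𝓞 L) : L) ^ m * ((u : 𝓞 L) : L) ^ (m - 1) := by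
    obtain ⟨k, rfl⟩ := Nat.exists_eq_succ_of_ne_zero hm.ne'
    rw [coe_inv_unit, Nat.succ_eq_add_one, Nat.add_sub_cancel, pow_succ', mul_assoc, ← mul_pow,
      inv_mul_cancel₀ (unit_ne_zero u), one_pow, mul_one]
  rw [h']
  exact mul_mem_coeffRing h (pow_mem_coeffRing hu _)

theorem inv_mem_relUnits (hb : ∀ i, IsIntegral ℤ (b i)) {x : L}
    (hx : x ∈ relUnits K L (fullModule K (fun i => b i))) :
    x⁻¹ ∈ relUnits K L (fullModule K (fun i => b i)) := by
  obtain ⟨⟨hx, u, rfl⟩, n, hn, h⟩ := hx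
  refine ⟨⟨inv_mem_coeffRing b hb u hx, u⁻¹, coe_inv_unit u⟩, n, hn, ?_⟩
  have h' : Algebra.norm K ((u : 𝓞 L) : L)⁻¹ * Algebra.norm K ((u : 𝓞 L) : L) = 1 := by
    rw [← map_mul, inv_mul_cancel₀ (unit_ne_zero u), map_one]
  rw [eq_inv_of_mul_eq_one_left h', inv_pow, h, inv_one]

theorem mul_mem_relUnits {M : Set L} {x y : L} (hx : x ∈ relUnits K L M)
    (hy : y ∈ relUnits K L M) : x * y ∈ relUnits K L M := by
  obtain ⟨⟨hx, u, rfl⟩, n, hn, h⟩ := hx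
  obtain ⟨⟨hy, v, rfl⟩, m, hm, h'⟩ := hy
  refine ⟨⟨mul_mem_coeffRing hx hy, u * v, by simp⟩, n * m, Nat.mul_pos hn hm, ?_⟩
  rw [map_mul, mul_pow, pow_mul, h, one_pow, mul_comm n m, pow_mul, h', one_pow, one_mul]

theorem one_mem_relUnits {M : Set L} : (1 : L) ∈ relUnits K L M :=
  ⟨⟨one_mem_coeffRing, 1, by simp⟩, 1, one_pos, by simp⟩

theorem pow_mem_relUnits {M : Set L} {x : L} (hx : x ∈ relUnits K L M) (n : ℕ) :
    x ^ n ∈ relUnits K L M := by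
  induction n with
  | zero => simpa using one_mem_relUnits
  | succ n ih => exact pow_succ x n ▸ mul_mem_relUnits ih hx

theorem zpow_mem_relUnits (hb : ∀ i, IsIntegral ℤ (b i)) {x : L}
    (hx : x ∈ relUnits K L (fullModule K (fun i => b i))) (n : ℤ) :
    x ^ n ∈ relUnits K L (fullModule K (fun i => b i)) := by
  cases n with
  | ofNat n => simpa using pow_mem_relUnits hx n
  | negSucc n =>
    rw [zpow_negSucc]
    exact inv_mem_relUnits b hb (pow_mem_relUnits hx _)

theorem prod_mem_relUnits {M : Set L} {ι : Type*} (s : Finset ι) (f : ι → L)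
    (hf : ∀ i ∈ s, f i ∈ relUnits K L M) : ∏ i ∈ s, f i ∈ relUnits K L M := by
  classical
  induction s using Finset.induction_on with
  | empty => simpa using one_mem_relUnits
  | insert i s hi ih =>
    rw [Finset.prod_insert hi]
    exact mul_mem_relUnits (hf i (by simp)) (ih fun j hj => hf j (by simp [hj]))

theorem ne_zero_of_mem_relUnits {M : Set L} {x : L} (hx : x ∈ relUnits K L M) : x ≠ 0 := by
  obtain ⟨⟨-, u, rfl⟩, -⟩ := hx
  exact unit_ne_zero u

end FullModule

section Span

variable {K L : Type*} [Field K] [NumberField K] [Field L] [NumberField L] [Algebra K L]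
  {e : ℕ} (b : Basis (Fin e) K L)

theorem logVec_algebraMap (y : K) (w : InfinitePlace L) :
    logVec L (algebraMap K L y) w =
      w.mult / (w.comap (algebraMap K L)).mult * logVec K y (w.comap (algebraMap K L)) := by
  have h : ((w.comap (algebraMap K L)).mult : ℝ) ≠ 0 := by
    exact_mod_cast InfinitePlace.mult_ne_zero
  simp only [logVec, InfinitePlace.comap_apply]
  field_simp

/-- The endomorphism of the space of archimedean log vectors corresponding to
`x ↦ x ^ [L : K] / Norm x`. -/
noncomputable def relProj (K L : Type*) [Field K] [NumberField K] [Field L] [NumberField L]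
    [Algebra K L] : (InfinitePlace L → ℝ) →ₗ[ℝ] (InfinitePlace L → ℝ) :=
  LinearMap.pi fun w => (finrank K L : ℝ) • LinearMap.proj w -
    ((w.mult : ℝ) / (w.comap (algebraMap K L)).mult) •
      ∑ w' ∈ placesAbove K L (w.comap (algebraMap K L)), LinearMap.proj w'

theorem relProj_apply (z : InfinitePlace L → ℝ) (w : InfinitePlace L) :
    relProj K L z w = finrank K L * z w -
      ((w.mult : ℝ) / (w.comap (algebraMap K L)).mult) *
        ∑ w' ∈ placesAbove K L (w.comap (algebraMap K L)), z w' := by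
  simp [relProj]

theorem relProj_logVec {x : L} (hx : x ≠ 0) :
    relProj K L (logVec L x) =
      logVec L (x ^ finrank K L * (algebraMap K L (Algebra.norm K x))⁻¹) := by
  have hN : Algebra.norm K x ≠ 0 := Algebra.norm_ne_zero_iff.mpr hx
  rw [logVec_mul (pow_ne_zero _ hx) (inv_ne_zero (by simpa using hN)), logVec_inv, logVec_pow]
  ext w
  rw [relProj_apply, sum_placesAbove_logVec _ hx]
  simp only [Pi.add_apply, Pi.smul_apply, Pi.neg_apply, smul_eq_mul, logVec_algebraMap]
  ring

theorem exists_pow_mem_relUnits (hb : ∀ i, IsIntegral ℤ (b i)) (u : (𝓞 L)ˣ) :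
    ∃ m : ℕ, 0 < m ∧ (((u : 𝓞 L) : L) ^ finrank K L *
      (algebraMap K L (Algebra.norm K ((u : 𝓞 L) : L)))⁻¹) ^ m ∈
        relUnits K L (fullModule K (fun i => b i)) := by
  let N : (𝓞 K)ˣ := Units.map (RingOfIntegers.norm K) u
  let y : (𝓞 L)ˣ := u ^ finrank K L * (Units.map (algebraMap (𝓞 K) (𝓞 L) : 𝓞 K →* 𝓞 L) N)⁻¹
  have hy : ((y : 𝓞 L) : L) = ((u : 𝓞 L) : L) ^ finrank K L *
      (algebraMap K L (Algebra.norm K ((u : 𝓞 L) : L)))⁻¹ := by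
    simp only [y, Units.val_mul, map_mul, coe_inv_unit, Units.val_pow_eq_pow_val, map_pow]
    rfl
  obtain ⟨m, hm, h⟩ := exists_pow_mem_coeffRing b hb y
  refine ⟨m, hm, ?_⟩
  rw [← hy]
  refine ⟨⟨h, y ^ m, by simp⟩, 1, one_pos, ?_⟩
  have hne : algebraMap K L (Algebra.norm K ((u : 𝓞 L) : L)) ≠ 0 := by
    simp
  have hnorm : Algebra.norm K ((y : 𝓞 L) : L) = 1 := by
    have h1 : ((y : 𝓞 L) : L) * algebraMap K L (Algebra.norm K ((u : 𝓞 L) : L)) =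
        ((u : 𝓞 L) : L) ^ finrank K L := by
      rw [hy, mul_assoc, inv_mul_cancel₀ hne, mul_one]
    have h2 := congrArg (Algebra.norm K) h1
    rw [map_mul, Algebra.norm_algebraMap, map_pow] at h2
    refine mul_right_cancel₀ ?_ (h2.trans (one_mul _).symm)
    exact pow_ne_zero _ (Algebra.norm_ne_zero_iff.mpr (unit_ne_zero u))
  rw [map_pow, hnorm, one_pow, one_pow]

theorem logVec_mem_span_of_maximal {r : ℕ} {M : Set L} (ε : Fin r → L)
    (hrank : ∀ η : Fin (r + 1) → L, (∀ i, η i ∈ relUnits K L M) → ¬ MulIndep η)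
    (hε : ∀ j, ε j ∈ relUnits K L M) (hind : MulIndep ε) {x : L} (hx : x ∈ relUnits K L M) :
    logVec L x ∈ Submodule.span ℝ (Set.range fun j => logVec L (ε j)) := by
  have h := hrank (Fin.cons x ε) (Fin.cases hx hε)
  simp only [MulIndep, not_forall] at h
  obtain ⟨m, hm, hne⟩ := h
  rw [Fin.prod_univ_succ] at hm
  simp only [Fin.cons_zero, Fin.cons_succ] at hm
  have h0 : m 0 ≠ 0 := by
    intro h0
    rw [h0, zpow_zero, one_mul] at hm
    have h1 := hind _ hm
    exact hne (funext (Fin.cases h0 fun j => congrFun h1 j))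
  have hlog := congrArg (logVec L) hm
  have hε0 (j : Fin r) : ε j ^ m j.succ ≠ 0 := zpow_ne_zero _ (ne_zero_of_mem_relUnits (hε j))
  rw [logVec_mul (zpow_ne_zero _ (ne_zero_of_mem_relUnits hx))
    (Finset.prod_ne_zero_iff.mpr fun j _ => hε0 j), logVec_prod _ _ fun j _ => hε0 j,
    logVec_one, logVec_zpow, add_eq_zero_iff_eq_neg] at hlog
  refine (Submodule.smul_mem_iff _ (Int.cast_ne_zero.mpr h0 : (m 0 : ℝ) ≠ 0)).mp ?_
  rw [hlog]
  refine neg_mem (Submodule.sum_mem _ fun j _ => ?_)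
  rw [logVec_zpow]
  exact Submodule.smul_mem _ _ (Submodule.subset_span ⟨j, rfl⟩)

/-- Log vectors of a maximal independent system of relative units span the space of vectors whose
sum over the places above each place of `K` vanishes. -/
theorem mem_span_logVec_relUnits (hb : ∀ i, IsIntegral ℤ (b i)) {r : ℕ} (ε : Fin r → L)
    (hrank : ∀ η : Fin (r + 1) → L,
      (∀ i, η i ∈ relUnits K L (fullModule K (fun i => b i))) → ¬ MulIndep η)
    (hε : ∀ j, ε j ∈ relUnits K L (fullModule K (fun i => b i))) (hind : MulIndep ε)
    (z : InfinitePlace L → ℝ)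
    (hz : ∀ v : InfinitePlace K, ∑ w ∈ placesAbove K L v, z w = 0) :
    z ∈ Submodule.span ℝ (Set.range fun j => logVec L (ε j)) := by
  have hsum : ∑ w, z w = 0 := by
    rw [sum_eq_sum_placesAbove (K := K)]
    exact Finset.sum_eq_zero fun v _ => hz v
  have hP : relProj K L z = (finrank K L : ℝ) • z := by
    ext w
    rw [relProj_apply, hz]
    simp
  have hmem := Submodule.mem_map_of_mem (f := relProj K L) (mem_span_logVec_units z hsum)
  rw [hP, Submodule.map_span] at hmem
  have : FiniteDimensional K L := b.finiteDimensional_of_finite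
  have he : (finrank K L : ℝ) ≠ 0 := by exact_mod_cast finrank_pos.ne'
  refine (Submodule.smul_mem_iff _ he).mp (Submodule.span_le.mpr ?_ hmem)
  rintro _ ⟨_, ⟨u, rfl⟩, rfl⟩
  obtain ⟨m, hm, h⟩ := exists_pow_mem_relUnits b hb u
  have h2 := logVec_mem_span_of_maximal ε hrank hε hind h
  rw [logVec_pow] at h2
  simp only [relProj_logVec (K := K) (unit_ne_zero u)]
  exact (Submodule.smul_mem_iff _ (by positivity : (m : ℝ) ≠ 0)).mp h2

end Span

section Height

variable {K L : Type*} [Field K] [NumberField K] [Field L] [NumberField L] [Algebra K L]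

theorem finLogAbs_nonpos {x : L} (hx : IsIntegral ℤ x)
    (v : IsDedekindDomain.HeightOneSpectrum (𝓞 L)) : finLogAbs L v x ≤ 0 := by
  rw [finLogAbs]
  split_ifs with h
  · exact le_rfl
  · have hle : v.valuation L x ≤ 1 := v.valuation_le_one (⟨x, hx⟩ : 𝓞 L)
    have hle' : Multiplicative.toAdd (WithZero.unzero h) ≤ 0 := by
      rw [← WithZero.coe_unzero h, ← WithZero.coe_one, WithZero.coe_le_coe] at hle
      exact hle
    refine mul_nonpos_of_nonpos_of_nonneg (div_nonpos_of_nonpos_of_nonneg ?_ ?_) ?_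
    · exact_mod_cast hle'
    · positivity
    · exact Real.log_natCast_nonneg _

theorem weilHeight_of_isIntegral {x : L} (hx : IsIntegral ℤ x) :
    weilHeight L x = (finrank ℚ L : ℝ)⁻¹ * ∑ w, max 0 (logVec L x w) := by
  have h (v : IsDedekindDomain.HeightOneSpectrum (𝓞 L)) : max 0 (finLogAbs L v x) = 0 :=
    max_eq_left (finLogAbs_nonpos hx v)
  simp only [weilHeight, h, finsum_zero, add_zero, Finset.mul_sum]
  refine Finset.sum_congr rfl fun w _ => ?_
  rw [mul_max_of_nonneg _ _ (by positivity), mul_zero, infLogAbs, logVec]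
  congr 1
  ring

theorem sum_max_smul_of_sum_eq_zero {ι : Type*} [Fintype ι] (a : ι → ℝ) (ha : ∑ i, a i = 0)
    (s : ℝ) : ∑ i, max 0 (s * a i) = |s| * ∑ i, max 0 (a i) := by
  have h (t : ℝ) : max 0 t = (|t| + t) / 2 := by
    rw [max_def]
    split_ifs with ht
    · rw [abs_of_nonneg ht]; ring
    · rw [abs_of_neg (not_le.mp ht)]; ring
  simp only [h, abs_mul, ← Finset.sum_div, Finset.sum_add_distrib, ← Finset.mul_sum, ha]
  ring

/-- The sum of positive parts is subadditive. -/
theorem sum_max_add_sum_le {ι κ : Type*} [Fintype ι] [Fintype κ] (y : ι → ℝ) (a : κ → ι → ℝ) :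
    ∑ i, max 0 (y i + ∑ j, a j i) ≤ ∑ i, max 0 (y i) + ∑ j, ∑ i, max 0 (a j i) := by
  rw [Finset.sum_comm, ← Finset.sum_add_distrib]
  refine Finset.sum_le_sum fun i _ => max_le ?_ (add_le_add (le_max_right _ _)
    (Finset.sum_le_sum fun j _ => le_max_right _ _))
  exact add_nonneg (le_max_left _ _) (Finset.sum_nonneg fun j _ => le_max_left _ _)

/-- The average of the log vector of `β` over the places above. -/
noncomputable def liftLogVec (L : Type*) [Field L] [NumberField L] [Algebra K L] (β : K) :
    InfinitePlace L → ℝ := fun w => (finrank K L : ℝ)⁻¹ * logVec L (algebraMap K L β) w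

theorem sum_placesAbove_mul_mult (v : InfinitePlace K) (f : InfinitePlace K → ℝ) :
    ∑ w ∈ placesAbove K L v, (finrank K L : ℝ)⁻¹ *
      (w.mult * f (w.comap (algebraMap K L))) = v.mult * f v := by
  have : FiniteDimensional K L := Module.Finite.right ℚ K L
  have he : (finrank K L : ℝ) ≠ 0 := by exact_mod_cast finrank_pos.ne'
  have h : ∀ w ∈ placesAbove K L v, (finrank K L : ℝ)⁻¹ *
      (w.mult * f (w.comap (algebraMap K L))) = (finrank K L : ℝ)⁻¹ * (w.mult * f v) := by
    intro w hw
    classical rw [(Finset.mem_filter.mp hw).2]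
  rw [Finset.sum_congr rfl h, ← Finset.mul_sum, ← Finset.sum_mul, sum_placesAbove_mult]
  field_simp

theorem sum_placesAbove_liftLogVec (β : K) (v : InfinitePlace K) :
    ∑ w ∈ placesAbove K L v, liftLogVec L β w = logVec K β v :=
  sum_placesAbove_mul_mult v fun v => Real.log (v β)

theorem sum_max_liftLogVec {β : K} (hβ : IsIntegral ℤ β) :
    (finrank ℚ L : ℝ)⁻¹ * ∑ w, max 0 (liftLogVec L β w) =
      (finrank K L : ℝ)⁻¹ * weilHeight K β := by
  have h (w : InfinitePlace L) : max 0 (liftLogVec L β w) = (finrank K L : ℝ)⁻¹ *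
      (w.mult * max 0 (Real.log (w.comap (algebraMap K L) β))) := by
    rw [mul_max_of_nonneg _ _ (by positivity), mul_max_of_nonneg _ _ (by positivity), mul_zero,
      mul_zero]
    rfl
  simp only [h]
  rw [sum_eq_sum_placesAbove (K := K)]
  simp only [sum_placesAbove_mul_mult (L := L) _ fun v => max 0 (Real.log (v β))]
  rw [weilHeight_of_isIntegral hβ, ← finrank_mul_finrank ℚ K L, Nat.cast_mul, mul_inv, mul_comm
    (finrank ℚ K : ℝ)⁻¹, mul_assoc]
  refine congrArg _ (congrArg _ (Finset.sum_congr rfl fun v _ => ?_))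
  rw [mul_max_of_nonneg _ _ (by positivity), mul_zero, logVec]

end Height

/-- **Main theorem, reformulated.** Let `𝔐 ⊆ O_l` be the full `O_k`-module generated by a
`k`-basis of `l` consisting of algebraic integers, let `β ≠ 0` in `O_k`, assume the group
`E_{l/k}(𝔐)` of relative units has positive rank `r`, and let `ε₁, …, ε_r` be
multiplicatively independent relative units.  If the solution set
`{μ ∈ 𝔐 : Norm_{l/k}(μ) ∈ Tor(O_k^×)·β}` is nonempty, then it contains an element `μ'`
with `h(μ') ≤ (1/2) ∑ⱼ h(εⱼ) + [l:k]⁻¹ h(β)`. -/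
theorem solution_set_contains_small_height_element
    (K L : Type*) [Field K] [NumberField K] [Field L] [NumberField L] [Algebra K L]
    (e : ℕ) (he : e = finrank K L) (b : Basis (Fin e) K L)
    (hbInt : ∀ i, IsIntegral ℤ (b i))
    (M : Set L) (hM : M = fullModule K (fun i => b i))
    (β : K) (hβInt : IsIntegral ℤ β) (hβ : β ≠ 0)
    -- `r` is the rank of the group `E_{l/k}(𝔐)` of relative units, and it is positive:
    (r : ℕ) (hr : 0 < r)
    (hrank : ∀ η : Fin (r + 1) → L, (∀ i, η i ∈ relUnits K L M) → ¬ MulIndep η)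
    (ε : Fin r → L) (hε : ∀ j, ε j ∈ relUnits K L M) (hind : MulIndep ε)
    (S : Set L)
    (hS : S = {x ∈ M | ∃ ζ : K, (∃ n : ℕ, 0 < n ∧ ζ ^ n = 1) ∧
        Algebra.norm K x = ζ * β})
    (hne : S.Nonempty) :
    ∃ μ' ∈ S, weilHeight L μ' ≤
      (1 / 2) * ∑ j, weilHeight L (ε j) + (finrank K L : ℝ)⁻¹ * weilHeight K β := by
  subst hM hS
  obtain ⟨μ, hμM, ζ, ⟨n, hn, hζ⟩, hμ⟩ := hne
  have hζ0 : ζ ≠ 0 := by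
    rintro rfl
    simp [hn.ne'] at hζ
  have hμ0 : μ ≠ 0 := by
    rintro rfl
    have : FiniteDimensional K L := b.finiteDimensional_of_finite
    rw [Algebra.norm_zero] at hμ
    exact mul_ne_zero hζ0 hβ hμ.symm
  have hε0 (j : Fin r) : ε j ≠ 0 := ne_zero_of_mem_relUnits (hε j)
  have hεInt (j : Fin r) : IsIntegral ℤ (ε j) := by
    obtain ⟨⟨-, u, hu⟩, -⟩ := hε j
    exact hu ▸ (u : 𝓞 L).isIntegral_coe
  have hεsum (j : Fin r) : ∑ w, logVec L (ε j) w = 0 := by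
    obtain ⟨⟨-, u, hu⟩, -⟩ := hε j
    rw [← hu]
    exact Units.sum_mult_mul_log u
  have hnorm : logVec K (Algebra.norm K μ) = logVec K β := by
    rw [hμ, logVec_mul hζ0 hβ, logVec_eq_zero_of_pow_eq_one hn hζ, zero_add]
  have hspan := mem_span_logVec_relUnits b hbInt ε hrank hε hind
    (logVec L μ - liftLogVec L β) fun v => by
      simp only [Pi.sub_apply, Finset.sum_sub_distrib, sum_placesAbove_liftLogVec,
        sum_placesAbove_logVec v hμ0, hnorm, sub_self]
  obtain ⟨t, ht⟩ := (Submodule.mem_span_range_iff_exists_fun ℝ).mp hspan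
  have hη : ∏ j, ε j ^ (-round (t j)) ∈ relUnits K L (fullModule K fun i => b i) :=
    prod_mem_relUnits _ _ fun j _ => zpow_mem_relUnits b hbInt (hε j) _
  have hη0 (j : Fin r) : ε j ^ (-round (t j)) ≠ 0 := zpow_ne_zero _ (hε0 j)
  have hmem : (∏ j, ε j ^ (-round (t j))) * μ ∈ fullModule K fun i => b i := hη.1.1 μ hμM
  have hlog : logVec L ((∏ j, ε j ^ (-round (t j))) * μ) =
      fun w => liftLogVec L β w + ∑ j, (t j - round (t j)) * logVec L (ε j) w := by
    rw [logVec_mul (ne_zero_of_mem_relUnits hη) hμ0, logVec_prod _ _ fun j _ => hη0 j]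
    ext w
    have hw := congrFun ht w
    simp only [Finset.sum_apply, Pi.smul_apply, smul_eq_mul, Pi.sub_apply] at hw
    simp only [Pi.add_apply, Finset.sum_apply, logVec_zpow, Pi.smul_apply, smul_eq_mul, sub_mul,
      Finset.sum_sub_distrib, hw, Int.cast_neg, neg_mul, Finset.sum_neg_distrib]
    ring
  refine ⟨_, ⟨hmem, Algebra.norm K (∏ j, ε j ^ (-round (t j))) * ζ, ?_, ?_⟩, ?_⟩
  · obtain ⟨-, m, hm, h⟩ := hη
    refine ⟨m * n, Nat.mul_pos hm hn, ?_⟩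
    rw [mul_pow, pow_mul, h, one_pow, mul_comm m, pow_mul, hζ, one_pow, one_mul]
  · rw [map_mul, hμ, mul_assoc]
  · rw [weilHeight_of_isIntegral (isIntegral_of_mem_fullModule b hbInt hmem), hlog,
      ← sum_max_liftLogVec (L := L) hβInt]
    simp only [weilHeight_of_isIntegral (hεInt _)]
    calc (finrank ℚ L : ℝ)⁻¹ * ∑ w, max 0 (liftLogVec L β w +
          ∑ j, (t j - round (t j)) * logVec L (ε j) w)
        ≤ (finrank ℚ L : ℝ)⁻¹ * (∑ w, max 0 (liftLogVec L β w) +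
          ∑ j, ∑ w, max 0 ((t j - round (t j)) * logVec L (ε j) w)) := by
          refine mul_le_mul_of_nonneg_left ?_ (by positivity)
          exact sum_max_add_sum_le _ fun j w => (t j - round (t j)) * logVec L (ε j) w
      _ ≤ (finrank ℚ L : ℝ)⁻¹ * (∑ w, max 0 (liftLogVec L β w) +
          ∑ j, 1 / 2 * ∑ w, max 0 (logVec L (ε j) w)) := by
          gcongr with j
          rw [sum_max_smul_of_sum_eq_zero _ (hεsum j)]
          gcongr
          exact abs_sub_round (t j)
      _ = _ := by
          rw [mul_add, add_comm, ← Finset.mul_sum, ← Finset.mul_sum, mul_left_comm]
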